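/- Let 1 < p < 2 with conjugate exponent p', and let H_n denote the 2^{n−1} × 2^{n−1} Hadamard matrices (H₁ = [1], H_{n+1} = [[H_n, H_n], [H_n, −H_n]]). Let U be the block-diagonal operator ⊕_{n≥1} 2^{−(n−1)/p'} H_n, regarded as a bounded linear operator from X_p = (⊕_{n≥1} ℓ_p^{2^{n−1}})_{ℓ_p} to (⊕_{n≥1} ℓ_∞^{2^{n−1}})_{ℓ_∞} (the latter is canonically isometric to ℓ_∞, and U is well defined with ‖U‖ ≤ 1 since ‖2^{−(n−1)/p'} H_n‖_{p,∞} ≤ 1 for every n). Then U does not belong to the closed linear span in L(X_p, ℓ_∞) of the set of operators from X_p to ℓ_∞ that factor through the Hilbert space ℓ₂. -/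

import Mathlib

open scoped ENNReal

set_option synthInstance.maxHeartbeats 1000000
set_option maxHeartbeats 1000000

noncomputable section

/-- The Hadamard matrices: `hadamard 0 = [1]` is `1 × 1`, and
`hadamard (m+1) = [[hadamard m, hadamard m], [hadamard m, -hadamard m]]`
is `2^(m+1) × 2^(m+1)` (so `hadamard (n-1)` is the `n`-th Hadamard matrix `H_n`). -/
def hadamard : (m : ℕ) → Matrix (Fin (2 ^ m)) (Fin (2 ^ m)) ℝ
  | 0 => 1
  | m + 1 =>
    Matrix.reindex (finSumFinEquiv.trans (finCongr (by rw [pow_succ, mul_two])))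
      (finSumFinEquiv.trans (finCongr (by rw [pow_succ, mul_two])))
      (Matrix.fromBlocks (hadamard m) (hadamard m) (hadamard m) (-hadamard m))

/-- The closed linear span of the operators `X → Y` factoring through the real
Hilbert space `ℓ₂`. -/
def closedSpanHilbertFactorable (X Y : Type*)
    [NormedAddCommGroup X] [NormedSpace ℝ X] [NormedAddCommGroup Y] [NormedSpace ℝ Y] :
    Submodule ℝ (X →L[ℝ] Y) :=
  (Submodule.span ℝ {T : X →L[ℝ] Y | ∃ (A : X →L[ℝ] lp (fun _ : ℕ => ℝ) 2)
      (B : lp (fun _ : ℕ => ℝ) 2 →L[ℝ] Y), T = B.comp A}).topologicalClosure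

theorem had_abs (m : ℕ) (i j : Fin (2 ^ m)) : hadamard m i j * hadamard m i j = 1 := by
  induction m with
  | zero =>
    have : i = j := Subsingleton.elim (α := Fin 1) i j
    subst this
    simp only [hadamard, Matrix.one_apply_eq, mul_one]
  | succ m ih =>
    simp only [hadamard, Matrix.reindex_apply, Matrix.submatrix_apply]
    generalize (Equiv.symm _ i) = a
    generalize (Equiv.symm _ j) = b
    rcases a with a | a <;> rcases b with b | b <;> simp [ih]

theorem had_orth (m : ℕ) : (hadamard m).transpose * hadamard m = (2 ^ m : ℝ) • 1 := by
  induction m with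
  | zero => simp [hadamard]
  | succ m ih =>
    simp only [hadamard, Matrix.reindex_apply, Matrix.transpose_submatrix]
    rw [Matrix.submatrix_mul_equiv, Matrix.fromBlocks_transpose, Matrix.fromBlocks_multiply]
    simp only [Matrix.transpose_neg, Matrix.neg_mul, Matrix.mul_neg, neg_neg, ih]
    rw [← sub_eq_add_neg, sub_self, ← add_smul, ← mul_two, ← pow_succ]
    have h : Matrix.fromBlocks ((2 ^ (m + 1) : ℝ) • (1 : Matrix (Fin (2 ^ m)) (Fin (2 ^ m)) ℝ))
        0 0 ((2 ^ (m + 1) : ℝ) • (1 : Matrix (Fin (2 ^ m)) (Fin (2 ^ m)) ℝ)) =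
        (2 ^ (m + 1) : ℝ) • 1 := by
      rw [← Matrix.fromBlocks_one, Matrix.fromBlocks_smul, smul_zero]
    rw [h, Matrix.submatrix_smul]
    simp only [Pi.smul_apply, Matrix.submatrix_one_equiv]

theorem had_energy {H : Type*} [NormedAddCommGroup H] [InnerProductSpace ℝ H] (m : ℕ)
    (v : Fin (2 ^ m) → H) :
    ∑ i, ‖∑ j, hadamard m i j • v j‖ ^ 2 = 2 ^ m * ∑ j, ‖v j‖ ^ 2 := by
  have h : ∀ j k, ∑ i, hadamard m i j * hadamard m i k = if j = k then (2 ^ m : ℝ) else 0 := by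
    intro j k
    have := congrFun (congrFun (had_orth m) j) k
    simpa [Matrix.mul_apply, Matrix.one_apply] using this
  calc ∑ i, ‖∑ j, hadamard m i j • v j‖ ^ 2
      = ∑ i, ∑ j, ∑ k, (hadamard m i j * hadamard m i k) * inner ℝ (v j) (v k) := by
        refine Finset.sum_congr rfl fun i _ => ?_
        rw [← real_inner_self_eq_norm_sq, sum_inner]
        refine Finset.sum_congr rfl fun j _ => ?_
        rw [inner_sum]
        refine Finset.sum_congr rfl fun k _ => ?_
        rw [real_inner_smul_left, real_inner_smul_right]; ring
    _ = ∑ j, ∑ k, (∑ i, hadamard m i j * hadamard m i k) * inner ℝ (v j) (v k) := by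
        rw [Finset.sum_comm]
        refine Finset.sum_congr rfl fun j _ => ?_
        rw [Finset.sum_comm]
        refine Finset.sum_congr rfl fun k _ => ?_
        rw [Finset.sum_mul]
    _ = _ := by
        simp only [h, ite_mul, zero_mul, Finset.sum_ite_eq, Finset.mem_univ, if_true,
          Finset.mul_sum, real_inner_self_eq_norm_sq]

theorem had_energy_le {H : Type*} [NormedAddCommGroup H] [InnerProductSpace ℝ H] (m : ℕ)
    (v : Fin (2 ^ m) → H) (C : ℝ) (hC : 0 ≤ C) (hv : ∀ j, ‖v j‖ ≤ C) :
    ∑ i, ‖∑ j, hadamard m i j • v j‖ ≤ C * (2 ^ m : ℝ) ^ (3 / 2 : ℝ) := by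
  have h2 : ∑ j, ‖v j‖ ^ 2 ≤ 2 ^ m * C ^ 2 := by
    calc ∑ j, ‖v j‖ ^ 2 ≤ ∑ j : Fin (2 ^ m), C ^ 2 :=
          Finset.sum_le_sum fun j _ => pow_le_pow_left₀ (norm_nonneg _) (hv j) 2
      _ = _ := by simp
  have h3 := sq_sum_le_card_mul_sum_sq (s := Finset.univ)
    (f := fun i => ‖∑ j, hadamard m i j • v j‖)
  rw [had_energy] at h3
  simp only [Finset.card_univ, Fintype.card_fin, Nat.cast_pow, Nat.cast_ofNat] at h3
  have hN : (0 : ℝ) < 2 ^ m := by positivity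
  refine abs_le_of_sq_le_sq' ?_ (by positivity) |>.2
  rw [mul_pow, ← Real.rpow_natCast ((2 ^ m : ℝ) ^ (3 / 2 : ℝ)), ← Real.rpow_mul hN.le]
  norm_num
  calc _ ≤ _ := h3
    _ ≤ 2 ^ m * (2 ^ m * (2 ^ m * C ^ 2)) := by gcongr
    _ = _ := by ring

abbrev XX (p : ℝ) [Fact (1 ≤ ENNReal.ofReal p)] :=
  lp (fun n : ℕ => PiLp (ENNReal.ofReal p) (fun _ : Fin (2 ^ n) => ℝ)) (ENNReal.ofReal p)

abbrev YY := lp (fun n : ℕ => (Fin (2 ^ n) → ℝ)) ∞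

def sv (p : ℝ) [Fact (1 ≤ ENNReal.ofReal p)] (n : ℕ) (f : Fin (2 ^ n) → ℝ) : XX p :=
  lp.single (ENNReal.ofReal p) n (WithLp.toLp (ENNReal.ofReal p) f)

theorem sv_apply (p : ℝ) [Fact (1 ≤ ENNReal.ofReal p)] (n : ℕ) (f : Fin (2 ^ n) → ℝ)
    (j : Fin (2 ^ n)) : (sv p n f : XX p) n j = f j := by
  simp [sv]

theorem sv_norm (p : ℝ) (hp : 1 < p) [Fact (1 ≤ ENNReal.ofReal p)] (n : ℕ)
    (f : Fin (2 ^ n) → ℝ) : ‖sv p n f‖ = (∑ j, |f j| ^ p) ^ (1 / p) := by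
  have h0 : (ENNReal.ofReal p).toReal = p := ENNReal.toReal_ofReal (by linarith)
  rw [sv, lp.norm_single (by simp; linarith), PiLp.norm_eq_sum (by rw [h0]; linarith), h0]
  simp

theorem sv_sum (p : ℝ) [Fact (1 ≤ ENNReal.ofReal p)] (n : ℕ) (f : Fin (2 ^ n) → ℝ) :
    sv p n f = ∑ j, f j • sv p n (Pi.single j 1) := by
  have h : ∀ g : Fin (2 ^ n) → ℝ, sv p n g =
      (lp.lsingle (𝕜 := ℝ) (E := fun n : ℕ => PiLp (ENNReal.ofReal p) (fun _ : Fin (2 ^ n) => ℝ))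
        (ENNReal.ofReal p) n).comp
        (WithLp.linearEquiv (ENNReal.ofReal p) ℝ (Fin (2 ^ n) → ℝ)).symm.toLinearMap g :=
    fun _ => rfl
  simp only [h, ← map_smul, ← map_sum]
  congr 1
  exact pi_eq_sum_univ' f |>.trans (by
    refine Finset.sum_congr rfl fun j _ => ?_
    congr 1)

theorem row_norm (p : ℝ) (hp : 1 < p) [Fact (1 ≤ ENNReal.ofReal p)] (n : ℕ)
    (i : Fin (2 ^ n)) : ‖sv p n (hadamard n i)‖ = (2 ^ n : ℝ) ^ (1 / p) := by
  have h : ∀ j, |hadamard n i j| = 1 := by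
    intro j
    have := had_abs n i j
    rcases mul_self_eq_one_iff.1 this with h | h <;> simp [h]
  rw [sv_norm p hp]
  simp [h]

theorem unit_norm (p : ℝ) (hp : 1 < p) [Fact (1 ≤ ENNReal.ofReal p)] (n : ℕ)
    (i : Fin (2 ^ n)) : ‖sv p n (Pi.single i 1)‖ = 1 := by
  rw [sv_norm p hp, Finset.sum_eq_single i]
  · simp
  · intro j _ hj
    rw [Pi.single_eq_of_ne hj, abs_zero, Real.zero_rpow (by linarith)]
  · simp

theorem YY_le (y : YY) (n : ℕ) (i : Fin (2 ^ n)) : |y n i| ≤ ‖y‖ :=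
  (norm_le_pi_norm (y n) i).trans (lp.norm_apply_le_norm (by simp) y n)

def ph (p p' : ℝ) [Fact (1 ≤ ENNReal.ofReal p)] (n : ℕ) (T : XX p →L[ℝ] YY) : ℝ :=
  (2 ^ n : ℝ) ^ (1 / p' - 2) * ∑ i, T (sv p n (hadamard n i)) n i

theorem ph_bound (p p' : ℝ) (hp : 1 < p) (hconj : 1 / p + 1 / p' = 1)
    [Fact (1 ≤ ENNReal.ofReal p)] (n : ℕ) (T : XX p →L[ℝ] YY) : |ph p p' n T| ≤ ‖T‖ := by
  have hN : (0 : ℝ) < 2 ^ n := by positivity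
  have h1 : |∑ i, T (sv p n (hadamard n i)) n i| ≤ 2 ^ n * (‖T‖ * (2 ^ n : ℝ) ^ (1 / p)) := by
    calc _ ≤ ∑ i, |T (sv p n (hadamard n i)) n i| := Finset.abs_sum_le_sum_abs _ _
      _ ≤ ∑ i : Fin (2 ^ n), ‖T‖ * (2 ^ n : ℝ) ^ (1 / p) := by
        refine Finset.sum_le_sum fun i _ => (YY_le _ n i).trans ?_
        rw [← row_norm p hp n i]
        exact T.le_opNorm _
      _ = _ := by simp
  rw [ph, abs_mul, abs_of_pos (by positivity)]
  calc _ ≤ (2 ^ n : ℝ) ^ (1 / p' - 2) * (2 ^ n * (‖T‖ * (2 ^ n : ℝ) ^ (1 / p))) := by gcongr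
    _ = ‖T‖ * ((2 ^ n : ℝ) ^ (1 / p' - 2) * (2 ^ n : ℝ) ^ (1 : ℝ) * (2 ^ n : ℝ) ^ (1 / p)) := by
        rw [Real.rpow_one]; ring
    _ = ‖T‖ := by
        rw [← Real.rpow_add hN, ← Real.rpow_add hN,
          show 1 / p' - 2 + 1 + 1 / p = 0 by linarith]; simp
    _ ≤ _ := le_rfl

theorem ph_add (p p' : ℝ) [Fact (1 ≤ ENNReal.ofReal p)] (n : ℕ) (S T : XX p →L[ℝ] YY) :
    ph p p' n (S + T) = ph p p' n S + ph p p' n T := by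
  simp [ph, Finset.sum_add_distrib, mul_add]

theorem ph_smul (p p' : ℝ) [Fact (1 ≤ ENNReal.ofReal p)] (n : ℕ) (a : ℝ) (T : XX p →L[ℝ] YY) :
    ph p p' n (a • T) = a * ph p p' n T := by
  simp [ph, ← Finset.mul_sum]; ring

theorem ph_fact (p p' : ℝ) (hp : 1 < p)
    [Fact (1 ≤ ENNReal.ofReal p)] (n : ℕ) (A : XX p →L[ℝ] lp (fun _ : ℕ => ℝ) 2)
    (B : lp (fun _ : ℕ => ℝ) 2 →L[ℝ] YY) :
    |ph p p' n (B.comp A)| ≤ ‖B‖ * ‖A‖ * (2 ^ n : ℝ) ^ (1 / p' - 1 / 2) := by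
  have hN : (0 : ℝ) < 2 ^ n := by positivity
  have h1 : |∑ i, (B.comp A) (sv p n (hadamard n i)) n i| ≤
      ‖B‖ * (‖A‖ * (2 ^ n : ℝ) ^ (3 / 2 : ℝ)) := by
    calc _ ≤ ∑ i, |(B.comp A) (sv p n (hadamard n i)) n i| := Finset.abs_sum_le_sum_abs _ _
      _ ≤ ∑ i, ‖B‖ * ‖∑ j, hadamard n i j • A (sv p n (Pi.single j 1))‖ := by
        refine Finset.sum_le_sum fun i _ => (YY_le _ n i).trans ?_
        rw [sv_sum, ContinuousLinearMap.comp_apply, map_sum]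
        simp only [map_smul]
        exact B.le_opNorm _
      _ = ‖B‖ * ∑ i, ‖∑ j, hadamard n i j • A (sv p n (Pi.single j 1))‖ := by
        rw [Finset.mul_sum]
      _ ≤ _ := by
        gcongr
        refine had_energy_le n _ _ (norm_nonneg _) fun j => ?_
        have := A.le_opNorm (sv p n (Pi.single j 1))
        rwa [unit_norm p hp, mul_one] at this
  rw [ph, abs_mul, abs_of_pos (by positivity)]
  calc _ ≤ (2 ^ n : ℝ) ^ (1 / p' - 2) * (‖B‖ * (‖A‖ * (2 ^ n : ℝ) ^ (3 / 2 : ℝ))) := by gcongr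
    _ = ‖B‖ * ‖A‖ * ((2 ^ n : ℝ) ^ (1 / p' - 2) * (2 ^ n : ℝ) ^ (3 / 2 : ℝ)) := by ring
    _ = _ := by
        rw [← Real.rpow_add hN]; congr 2; ring

open Filter Topology in
theorem ph_tendsto (p p' : ℝ) (hp : 1 < p) (hp2 : p < 2) (hconj : 1 / p + 1 / p' = 1)
    [Fact (1 ≤ ENNReal.ofReal p)] (A : XX p →L[ℝ] lp (fun _ : ℕ => ℝ) 2)
    (B : lp (fun _ : ℕ => ℝ) 2 →L[ℝ] YY) :
    Tendsto (fun n => ph p p' n (B.comp A)) atTop (𝓝 0) := by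
  refine squeeze_zero_norm (fun n => ph_fact p p' hp n A B) ?_
  have h : 1 / p' - 1 / 2 < 0 := by
    have : 1 / 2 < 1 / p := one_div_lt_one_div_of_lt (by linarith) hp2
    linarith
  rw [← mul_zero (‖B‖ * ‖A‖)]
  refine Tendsto.const_mul _ ?_
  have h2 : Tendsto (fun n : ℕ => (2 ^ n : ℝ)) atTop atTop :=
    tendsto_pow_atTop_atTop_of_one_lt (by norm_num)
  have := (tendsto_rpow_neg_atTop (y := -(1 / p' - 1 / 2)) (by linarith)).comp h2
  simpa [Function.comp_def] using this

/-- let `1 < p < 2` with conjugate exponent `p'`, and let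
`U : X_p = (⊕ ℓ_p^{2^{n-1}})_{ℓ_p} → (⊕ ℓ_∞^{2^{n-1}})_{ℓ_∞}` be the block-diagonal
operator `⊕ₙ 2^{-(n-1)/p'} H_n` built from the Hadamard matrices.  Then `U` does not
belong to the closed linear span of the operators factoring through `ℓ₂`. -/
theorem statement19 (p p' : ℝ) (hp1 : 1 < p) (hp2 : p < 2)
    (hconj : 1 / p + 1 / p' = 1) [Fact (1 ≤ ENNReal.ofReal p)]
    (U : lp (fun n : ℕ => PiLp (ENNReal.ofReal p) (fun _ : Fin (2 ^ n) => ℝ))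
          (ENNReal.ofReal p) →L[ℝ]
        lp (fun n : ℕ => (Fin (2 ^ n) → ℝ)) ∞)
    (hU : ∀ (x : lp (fun n : ℕ => PiLp (ENNReal.ofReal p) (fun _ : Fin (2 ^ n) => ℝ))
          (ENNReal.ofReal p)) (n : ℕ) (i : Fin (2 ^ n)),
      U x n i = (2 : ℝ) ^ (-(n : ℝ) / p') *
        Matrix.mulVec (hadamard n) (fun j => x n j) i) :
    U ∉ closedSpanHilbertFactorable
      (lp (fun n : ℕ => PiLp (ENNReal.ofReal p) (fun _ : Fin (2 ^ n) => ℝ))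
        (ENNReal.ofReal p))
      (lp (fun n : ℕ => (Fin (2 ^ n) → ℝ)) ∞) := by
  intro hmem
  obtain ⟨T, hT, hd⟩ := Metric.mem_closure_iff.1 hmem (1 / 2) (by norm_num)
  rw [dist_eq_norm] at hd
  have hlim : Filter.Tendsto (fun n => ph p p' n T) Filter.atTop (nhds 0) := by
    refine Submodule.span_induction (p := fun T _ =>
      Filter.Tendsto (fun n => ph p p' n T) Filter.atTop (nhds 0)) ?_ ?_ ?_ ?_ hT
    · rintro _ ⟨A, B, rfl⟩
      exact ph_tendsto p p' hp1 hp2 hconj A B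
    · simp [ph]
    · intro S T _ _ hS hT
      simpa [ph_add] using hS.add hT
    · intro a S _ hS
      simpa [ph_smul] using hS.const_mul a
  have hU1 : ∀ n, ph p p' n U = 1 := by
    intro n
    have hN : (0 : ℝ) < 2 ^ n := by positivity
    have h1 : ∀ i, U (sv p n (hadamard n i)) n i = (2 : ℝ) ^ (-(n : ℝ) / p') * 2 ^ n := by
      intro i
      rw [hU]
      congr 1
      simp only [Matrix.mulVec, dotProduct, sv_apply, had_abs]
      simp
    rw [ph]
    simp only [h1]
    have h3 : (2 : ℝ) ^ (-(n : ℝ) / p') = (2 ^ n : ℝ) ^ (-(1 / p')) := by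
      rw [← Real.rpow_natCast 2 n, ← Real.rpow_mul (by norm_num)]
      congr 1; ring
    rw [h3]
    simp only [Finset.sum_const, Finset.card_univ, Fintype.card_fin, nsmul_eq_mul,
      Nat.cast_pow, Nat.cast_ofNat]
    calc _ = (2 ^ n : ℝ) ^ (1 / p' - 2) * (2 ^ n : ℝ) ^ (-(1 / p')) * (2 ^ n : ℝ) ^ (1 : ℝ)
          * (2 ^ n : ℝ) ^ (1 : ℝ) := by rw [Real.rpow_one]; ring
      _ = 1 := by
        rw [← Real.rpow_add hN, ← Real.rpow_add hN, ← Real.rpow_add hN,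
          show 1 / p' - 2 + -(1 / p') + 1 + 1 = 0 by ring, Real.rpow_zero]
  obtain ⟨n, hn⟩ := (hlim.eventually (gt_mem_nhds (show (0 : ℝ) < 1 / 2 by norm_num))).exists
  have hb := ph_bound p p' hp1 hconj n (U - T)
  have hs : ph p p' n U = ph p p' n (U - T) + ph p p' n T := by
    rw [← ph_add, sub_add_cancel]
  rw [hU1] at hs
  have := le_abs_self (ph p p' n (U - T))
  linarith


end
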